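/- For every l ≥ 1, the Jacobian algebra J_l = J(Diamond_l, W_l) is finite-dimensional over the base field k. -/

import Mathlib

noncomputable section
open scoped Classical

/-! ## The diamond quiver `Diamond_l`, its potential `W_l`, and the completed path algebra
(realized as the space of coefficient functions on paths). -/

/-- Ambient vertex labels: `(true, j, k)` is the positive label `(i;j,k)` and `(false, j, k)`
the negative label `(j,k;i)`, where `i = j + k`; horizontal labels (`j = 0` or `k = 0`) are
identified, with canonical sign `true`. -/
abbrev VT : Type := Bool × ℕ × ℕ

/-- Canonical representative of a label. -/
def canon (v : VT) : VT := if v.2.1 = 0 ∨ v.2.2 = 0 then (true, v.2.1, v.2.2) else v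

/-- The vertex set `Diamond_l^0`. -/
def IsVert (l : ℕ) (v : VT) : Prop := canon v = v ∧ 1 ≤ v.2.1 + v.2.2 ∧ v.2.1 + v.2.2 ≤ l

/-- Arrow types of `Diamond_l`. -/
inductive ArrT | A | B | C
deriving DecidableEq

instance : Fintype ArrT := ⟨⟨{ArrT.A, ArrT.B, ArrT.C}, by decide⟩, fun x => by cases x <;> decide⟩

/-- An arrow of `Diamond_l`: its type together with its raw (signed) source label.
Type `A`: `±(i;j,k) → ±(i−1;j−1,k)`; type `B`: `±(i;j,k) → ±(i+1;j,k+1)`;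
type `C`: `±(i;j,k) → ±(i;j+1,k−1)`.  The two type-`C` arrows `(1;0,1) → (1;1,0)` are
realized as the two raw signs. -/
abbrev Arr : Type := ArrT × VT

/-- The raw target of an arrow. -/
def rawTgt : Arr → VT
  | (ArrT.A, s, j, k) => (s, j - 1, k)
  | (ArrT.B, s, j, k) => (s, j, k + 1)
  | (ArrT.C, s, j, k) => (s, j + 1, k - 1)

/-- Source vertex of an arrow. -/
def asrc (a : Arr) : VT := canon a.2

/-- Target vertex of an arrow. -/
def atgt (a : Arr) : VT := canon (rawTgt a)

/-- Whether an arrow belongs to `Diamond_l`.  Raw sign `false` is excluded when both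
endpoints are horizontal, except for the doubled type-`C` arrows `(1;0,1) → (1;1,0)`. -/
def ValidArr (l : ℕ) : Arr → Prop
  | (ArrT.A, s, j, k) => 1 ≤ j ∧ 2 ≤ j + k ∧ j + k ≤ l ∧ (k = 0 → s = true)
  | (ArrT.B, s, j, k) => 1 ≤ j + k ∧ j + k + 1 ≤ l ∧ (j = 0 → s = true)
  | (ArrT.C, _, j, k) => 1 ≤ k ∧ j + k ≤ l

/-- Both endpoints of the arrow are horizontal vertices (i.e. the arrow lies on the axis). -/
def bothHoriz (a : Arr) : Prop :=
  (a.2.2.1 = 0 ∨ a.2.2.2 = 0) ∧ ((rawTgt a).2.1 = 0 ∨ (rawTgt a).2.2 = 0)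

/-- The arrow is nonnegative (lies on or above the axis). -/
def nonnegA (a : Arr) : Prop := a.2.1 = true

/-- The arrow is nonpositive (lies on or below the axis). -/
def nonposA (a : Arr) : Prop := a.2.1 = false ∨ (bothHoriz a ∧ a.1 ≠ ArrT.C)

/-- A path datum: a starting vertex together with a list of arrows. -/
abbrev PathD : Type := VT × List Arr

/-- Wellformedness of a list of arrows starting at `v`. -/
def WFfrom (l : ℕ) : VT → List Arr → Prop
  | v, [] => IsVert l v
  | v, a :: L => ValidArr l a ∧ asrc a = v ∧ WFfrom l (atgt a) L

/-- Wellformedness of a path datum. -/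
def WFpath (l : ℕ) (p : PathD) : Prop := WFfrom l p.1 p.2

/-- The end vertex of a path. -/
def endV : VT → List Arr → VT
  | v, [] => v
  | _, a :: L => endV (atgt a) L

/-- An element of the completed path algebra of `Diamond_l` is a coefficient function on
paths (supported on wellformed paths). -/
abbrev CPA : Type := PathD → ℂ

/-- The coefficient function of the potential
`W_l = (a₊b₊c₊ − a₊c₊b₊) + (a₋b₋c₋ − a₋c₋b₋)`. -/
def Wpot (l : ℕ) : CPA := fun p =>
  match p with
  | (v, [x, y, z]) =>
    (if WFfrom l v [x, y, z] ∧ endV v [x, y, z] = v ∧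
        x.1 = ArrT.A ∧ y.1 = ArrT.B ∧ z.1 = ArrT.C ∧
        nonnegA x ∧ nonnegA y ∧ nonnegA z then 1 else 0)
    - (if WFfrom l v [x, y, z] ∧ endV v [x, y, z] = v ∧
        x.1 = ArrT.A ∧ y.1 = ArrT.C ∧ z.1 = ArrT.B ∧
        nonnegA x ∧ nonnegA y ∧ nonnegA z then 1 else 0)
    + (if WFfrom l v [x, y, z] ∧ endV v [x, y, z] = v ∧
        x.1 = ArrT.A ∧ y.1 = ArrT.B ∧ z.1 = ArrT.C ∧
        nonposA x ∧ nonposA y ∧ nonposA z then 1 else 0)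
    - (if WFfrom l v [x, y, z] ∧ endV v [x, y, z] = v ∧
        x.1 = ArrT.A ∧ y.1 = ArrT.C ∧ z.1 = ArrT.B ∧
        nonposA x ∧ nonposA y ∧ nonposA z then 1 else 0)
  | _ => 0

/-- The `r`-th rotation of a cyclic path. -/
def rotP (r : ℕ) (p : PathD) : PathD := (endV p.1 (p.2.take r), p.2.drop r ++ p.2.take r)

/-- The cyclic derivative `∂_a W` of a potential `W` with respect to an arrow `a`:
the coefficient of a path `p` (from `tgt a` to `src a`) is the sum of the coefficients of
`W` at all rotations of the cycle `a · p`. -/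
def cycDeriv (W : CPA) (a : Arr) : CPA := fun p =>
  if p.1 = atgt a ∧ endV p.1 p.2 = asrc a then
    ∑ r ∈ Finset.range (p.2.length + 1), W (rotP r (asrc a, a :: p.2))
  else 0

/-- The basis element of the path algebra attached to a path. -/
def deltaP (p : PathD) : CPA := fun q => if q = p then 1 else 0

/-- Left multiplication of a coefficient function by (the basis element of) a path. -/
def lmul (p : PathD) (f : CPA) : CPA := fun q =>
  if q.1 = p.1 ∧ p.2 <+: q.2 then f (endV p.1 p.2, q.2.drop p.2.length) else 0

/-- Right multiplication of a coefficient function by (the basis element of) a path. -/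
def rmul (f : CPA) (p : PathD) : CPA := fun q =>
  if p.2 <:+ q.2 ∧ endV q.1 (q.2.take (q.2.length - p.2.length)) = p.1 then
    f (q.1, q.2.take (q.2.length - p.2.length))
  else 0

/-- Generators `p · (∂_a W_l) · q` of the Jacobian ideal. -/
def jacGens (l : ℕ) : Set CPA :=
  {h | ∃ (a : Arr) (p q : PathD), ValidArr l a ∧ WFpath l p ∧ WFpath l q ∧
    endV p.1 p.2 = atgt a ∧ q.1 = asrc a ∧ h = lmul p (rmul (cycDeriv (Wpot l) a) q)}

/-- The closure (in the adic topology of the completed path algebra) of the span of a set: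
`f` lies in it iff for every `n` it agrees with an element of the span on all paths of
length `≤ n`. -/
def closSpan (S : Set CPA) : Set CPA :=
  {f | ∀ n : ℕ, ∃ g ∈ Submodule.span ℂ S, ∀ p : PathD, p.2.length ≤ n → f p = g p}

/-- Generators `c − rot(c)` of cyclic equivalence. -/
def cycGens (l : ℕ) : Set CPA :=
  {h | ∃ (p : PathD) (r : ℕ), WFpath l p ∧ endV p.1 p.2 = p.1 ∧ p.2 ≠ [] ∧
    h = deltaP p - deltaP (rotP r p)}

/-- A potential on `Diamond_l`: a (possibly infinite) linear combination of oriented cycles,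
i.e. a coefficient function supported on wellformed cycles of positive length. -/
def IsPotential (l : ℕ) (U : CPA) : Prop :=
  ∀ p, U p ≠ 0 → WFpath l p ∧ endV p.1 p.2 = p.1 ∧ p.2 ≠ []

/-- The completed path algebra of `Diamond_l`: coefficient functions supported on
wellformed paths. -/
def WFsupp (l : ℕ) : Submodule ℂ CPA where
  carrier := {f | ∀ p, ¬ WFpath l p → f p = 0}
  add_mem' := by intro f g hf hg p hp; simp [Pi.add_apply, hf p hp, hg p hp]
  zero_mem' := by intro p _; rfl
  smul_mem' := by intro c f hf p hp; simp [Pi.smul_apply, hf p hp]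

/-- The (closed two-sided) Jacobian ideal `∂W_l`, as a subspace of the space of coefficient
functions. -/
def JacIdeal (l : ℕ) : Submodule ℂ CPA where
  carrier := closSpan (jacGens l)
  add_mem' := by
    intro f g hf hg n
    obtain ⟨gf, hgf, hgf2⟩ := hf n
    obtain ⟨gg, hgg, hgg2⟩ := hg n
    exact ⟨gf + gg, Submodule.add_mem _ hgf hgg,
      fun p hp => by simp [Pi.add_apply, hgf2 p hp, hgg2 p hp]⟩
  zero_mem' := fun n => ⟨0, Submodule.zero_mem _, fun p _ => rfl⟩
  smul_mem' := by
    intro c f hf n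
    obtain ⟨gf, hgf, hgf2⟩ := hf n
    exact ⟨c • gf, Submodule.smul_mem _ c hgf,
      fun p hp => by simp [Pi.smul_apply, hgf2 p hp]⟩

/-- The Jacobian algebra `J_l = J(Diamond_l, W_l)`, as the quotient of the completed path
algebra by the Jacobian ideal. -/
def Jalg (l : ℕ) : Type :=
  ↥(WFsupp l) ⧸ (Submodule.comap (WFsupp l).subtype (JacIdeal l))

instance (l : ℕ) : AddCommGroup (Jalg l) :=
  inferInstanceAs (AddCommGroup (↥(WFsupp l) ⧸ (Submodule.comap (WFsupp l).subtype (JacIdeal l))))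

instance (l : ℕ) : Module ℂ (Jalg l) :=
  inferInstanceAs (Module ℂ (↥(WFsupp l) ⧸ (Submodule.comap (WFsupp l).subtype (JacIdeal l))))

/-! ### Wellformed paths -/

lemma isVert_canon {l : ℕ} {v : VT} (h1 : 1 ≤ v.2.1 + v.2.2) (h2 : v.2.1 + v.2.2 ≤ l) :
    IsVert l (canon v) := by
  obtain ⟨s, j, k⟩ := v
  unfold IsVert canon
  simp only at h1 h2
  by_cases h : j = 0 ∨ k = 0 <;> simp [h, h1, h2]

lemma isVert_asrc {l : ℕ} {a : Arr} (h : ValidArr l a) : IsVert l (asrc a) := by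
  obtain ⟨t, s, j, k⟩ := a
  cases t <;> simp only [ValidArr] at h <;> apply isVert_canon <;> simp only <;> omega

lemma isVert_atgt {l : ℕ} {a : Arr} (h : ValidArr l a) : IsVert l (atgt a) := by
  obtain ⟨t, s, j, k⟩ := a
  cases t <;> simp only [ValidArr] at h <;> apply isVert_canon <;> simp only [rawTgt] <;> omega

lemma WFfrom.isVert {l : ℕ} {v : VT} {L : List Arr} (h : WFfrom l v L) : IsVert l v := by
  cases L with
  | nil => exact h
  | cons a L => exact h.2.1 ▸ isVert_asrc h.1

lemma endV_append (v : VT) (L M : List Arr) : endV v (L ++ M) = endV (endV v L) M := by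
  induction L generalizing v with
  | nil => rfl
  | cons a L ih => exact ih _

lemma WFfrom_append {l : ℕ} {v : VT} {L M : List Arr} :
    WFfrom l v (L ++ M) ↔ WFfrom l v L ∧ WFfrom l (endV v L) M := by
  induction L generalizing v with
  | nil => exact ⟨fun h => ⟨h.isVert, h⟩, fun h => h.2⟩
  | cons a L ih => simp [WFfrom, ih, endV, and_assoc]

lemma WFfrom.validArr {l : ℕ} {v : VT} {L : List Arr} (h : WFfrom l v L) {a : Arr}
    (ha : a ∈ L) : ValidArr l a := by
  induction L generalizing v with
  | nil => simp at ha
  | cons b L ih =>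
    rcases List.mem_cons.1 ha with rfl | ha
    · exact h.1
    · exact ih h.2.2 ha

/-! ### Cyclic derivatives of the potential -/

/-- The arrow is nonnegative (for `s = true`), resp. nonpositive (for `s = false`). -/
def HasSign (s : Bool) (a : Arr) : Prop := if s = true then nonnegA a else nonposA a

/-- The arrows `x`, `y`, `z` form an oriented triangle of `Diamond_l`. -/
def Triangle (l : ℕ) (x y z : Arr) : Prop :=
  ValidArr l x ∧ ValidArr l y ∧ ValidArr l z ∧
    asrc y = atgt x ∧ asrc z = atgt y ∧ asrc x = atgt z

lemma Triangle.rotate {l : ℕ} {x y z : Arr} (h : Triangle l x y z) : Triangle l y z x :=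
  ⟨h.2.1, h.2.2.1, h.1, h.2.2.2.2.1, h.2.2.2.2.2, h.2.2.2.1⟩

lemma triangle_iff {l : ℕ} {v : VT} {x y z : Arr} :
    (WFfrom l v [x, y, z] ∧ endV v [x, y, z] = v) ↔ (v = asrc x ∧ Triangle l x y z) := by
  simp only [WFfrom, endV, Triangle]
  constructor
  · rintro ⟨⟨hx, rfl, hy, hxy, hz, hyz, -⟩, h⟩
    exact ⟨rfl, hx, hy, hz, hxy, hyz, h.symm⟩
  · rintro ⟨rfl, hx, hy, hz, hxy, hyz, h⟩
    exact ⟨⟨hx, rfl, hy, hxy, hz, hyz, isVert_atgt hz⟩, h.symm⟩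

/-- A valid arrow is determined by its type, source and sign. -/
lemma eq_of_asrc_eq {l : ℕ} {s : Bool} {x y : Arr} (hx : ValidArr l x) (hy : ValidArr l y)
    (hsx : HasSign s x) (hsy : HasSign s y) (ht : x.1 = y.1) (h : asrc x = asrc y) : x = y := by
  obtain ⟨t, s₁, j, k⟩ := x
  obtain ⟨t', s₂, j', k'⟩ := y
  obtain rfl : t = t' := ht
  have hj : j = j' := by
    have := congrArg (fun v => v.2.1) h
    unfold asrc canon at this
    split_ifs at this <;> exact this
  have hk : k = k' := by
    have := congrArg (fun v => v.2.2) h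
    unfold asrc canon at this
    split_ifs at this <;> exact this
  subst hj hk
  cases t <;> cases s <;> cases s₁ <;> cases s₂ <;>
    simp_all [ValidArr, HasSign, nonnegA, nonposA, bothHoriz, rawTgt]

/-- The sign of the cyclic word formed by three arrow types in the potential. -/
def cycSign : ArrT → ArrT → ArrT → ℂ
  | .A, .B, .C => 1
  | .B, .C, .A => 1
  | .C, .A, .B => 1
  | .A, .C, .B => -1
  | .C, .B, .A => -1
  | .B, .A, .C => -1
  | _, _, _ => 0

/-- The coefficient of an oriented triangle in the potential, read from its first arrow. -/
def triCoeff (x y z : Arr) : ℂ :=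
  (if x.1 = ArrT.A ∧ y.1 = ArrT.B ∧ z.1 = ArrT.C ∧ nonnegA x ∧ nonnegA y ∧ nonnegA z
      then 1 else 0)
    - (if x.1 = ArrT.A ∧ y.1 = ArrT.C ∧ z.1 = ArrT.B ∧ nonnegA x ∧ nonnegA y ∧ nonnegA z
      then 1 else 0)
    + (if x.1 = ArrT.A ∧ y.1 = ArrT.B ∧ z.1 = ArrT.C ∧ nonposA x ∧ nonposA y ∧ nonposA z
      then 1 else 0)
    - (if x.1 = ArrT.A ∧ y.1 = ArrT.C ∧ z.1 = ArrT.B ∧ nonposA x ∧ nonposA y ∧ nonposA z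
      then 1 else 0)

lemma Wpot_triple (l : ℕ) (v : VT) (x y z : Arr) :
    Wpot l (v, [x, y, z]) = if v = asrc x ∧ Triangle l x y z then triCoeff x y z else 0 := by
  by_cases h : v = asrc x ∧ Triangle l x y z
  · have h' := triangle_iff.2 h
    rw [if_pos h]
    simp only [Wpot, h'.1, h'.2, true_and, triCoeff]
  · have h' : ¬ (WFfrom l v [x, y, z] ∧ endV v [x, y, z] = v) := fun h' => h (triangle_iff.1 h')
    rw [if_neg h]
    simp only [Wpot, ← and_assoc, h', false_and, if_false]
    norm_num

lemma Wpot_eq_zero (l : ℕ) {p : PathD} (h : p.2.length ≠ 3) : Wpot l p = 0 := by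
  obtain ⟨v, L⟩ := p
  match L, h with
  | [], _ => rfl
  | [_], _ => rfl
  | [_, _], _ => rfl
  | [_, _, _], h => exact absurd rfl h
  | _ :: _ :: _ :: _ :: _, _ => rfl

lemma sum_triCoeff {s : Bool} {a : Arr} (ha : ∀ s', HasSign s' a ↔ s' = s) (x y : Arr) :
    triCoeff a x y + triCoeff x y a + triCoeff y a x =
      if HasSign s x ∧ HasSign s y then cycSign a.1 x.1 y.1 else 0 := by
  have h1 := ha true
  have h2 := ha false
  simp only [HasSign, if_true, Bool.false_eq_true, if_false] at h1 h2
  cases s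
  · by_cases hx : nonposA x <;> by_cases hy : nonposA y <;>
      rcases hta : a.1 <;> rcases htx : x.1 <;> rcases hty : y.1 <;>
      simp [triCoeff, HasSign, cycSign, *]
  · by_cases hx : nonnegA x <;> by_cases hy : nonnegA y <;>
      rcases hta : a.1 <;> rcases htx : x.1 <;> rcases hty : y.1 <;>
      simp [triCoeff, HasSign, cycSign, *]

lemma cycDeriv_Wpot {l : ℕ} {s : Bool} {a : Arr} (ha : ∀ s', HasSign s' a ↔ s' = s)
    (v : VT) (x y : Arr) :
    cycDeriv (Wpot l) a (v, [x, y]) =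
      if v = atgt a ∧ Triangle l a x y ∧ HasSign s x ∧ HasSign s y
        then cycSign a.1 x.1 y.1 else 0 := by
  unfold cycDeriv
  by_cases hv : v = atgt a
  swap
  · simp [hv]
  subst hv
  by_cases hT : Triangle l a x y
  · have he : endV (atgt a) [x, y] = asrc a := hT.2.2.2.2.2.symm
    have h2 := hT.rotate
    have h3 := h2.rotate
    rw [if_pos ⟨rfl, he⟩]
    simp only [Finset.sum_range_succ, Finset.sum_range_zero, rotP,
      List.length_cons, List.length_nil, List.take, List.drop, endV, List.nil_append,
      List.cons_append, Wpot_triple, hT, h2, h3, true_and, and_true, zero_add, if_true,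
      hT.2.2.2.1, hT.2.2.2.2.1, sum_triCoeff ha]
  · have h2 : ¬ Triangle l x y a := fun h => hT h.rotate.rotate
    have h3 : ¬ Triangle l y a x := fun h => hT h.rotate
    simp [Finset.sum_range_succ, rotP, endV, Wpot_triple, hT, h2, h3]

lemma cycDeriv_Wpot_eq_zero (l : ℕ) (a : Arr) {p : PathD} (h : p.2.length ≠ 2) :
    cycDeriv (Wpot l) a p = 0 := by
  unfold cycDeriv
  split_ifs
  · refine Finset.sum_eq_zero fun r hr => Wpot_eq_zero l ?_
    simp only [rotP, List.length_append, List.length_drop, List.length_take, List.length_cons,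
      Finset.mem_range] at hr ⊢
    omega
  · rfl

lemma Triangle.unique {l : ℕ} {s : Bool} {a x y x' y' : Arr} (h : Triangle l a x y)
    (h' : Triangle l a x' y') (hx : HasSign s x) (hy : HasSign s y) (hx' : HasSign s x')
    (hy' : HasSign s y') (htx : x.1 = x'.1) (hty : y.1 = y'.1) : x = x' ∧ y = y' := by
  obtain rfl := eq_of_asrc_eq h.2.1 h'.2.1 hx hx' htx (h.2.2.2.1.trans h'.2.2.2.1.symm)
  exact ⟨rfl, eq_of_asrc_eq h.2.2.1 h'.2.2.1 hy hy' hty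
    (h.2.2.2.2.1.trans h'.2.2.2.2.1.symm)⟩

lemma cycDeriv_Wpot_eq_sub {l : ℕ} {s : Bool} {a x y x' y' : Arr}
    (ha : ∀ s', HasSign s' a ↔ s' = s) (h : Triangle l a x y) (h' : Triangle l a x' y')
    (hx : HasSign s x) (hy : HasSign s y) (hx' : HasSign s x') (hy' : HasSign s y')
    (hax : a.1 ≠ x.1) (hay : a.1 ≠ y.1) (hxy : x.1 ≠ y.1) (htx : x'.1 = y.1) (hty : y'.1 = x.1) :
    cycDeriv (Wpot l) a = cycSign a.1 x.1 y.1 •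
      (deltaP (atgt a, [x, y]) - deltaP (atgt a, [x', y'])) := by
  funext ⟨v, L⟩
  by_cases hL : L.length = 2
  swap
  · rw [cycDeriv_Wpot_eq_zero l a hL]
    have h1 : ∀ z w : Arr, ((v, L) : PathD) ≠ (atgt a, [z, w]) := by
      
      rintro z w h
      apply hL
      rw [Prod.mk.injEq] at h
      simp [h.2]
    simp [deltaP, h1]
  obtain ⟨z, w, rfl⟩ := List.length_eq_two.1 hL
  rw [cycDeriv_Wpot ha]
  simp only [Pi.smul_apply, Pi.sub_apply, deltaP, Prod.mk.injEq, List.cons.injEq, and_true,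
    smul_eq_mul]
  by_cases h1 : z = x ∧ w = y
  · obtain ⟨rfl, rfl⟩ := h1
    have h2 : ¬ (z = x' ∧ w = y') := by rintro ⟨rfl, -⟩; exact hxy htx
    simp [h, hx, hy, h2]
  by_cases h2 : z = x' ∧ w = y'
  · obtain ⟨rfl, rfl⟩ := h2
    simp only [h', hx', hy', h1, htx, hty]
    by_cases hv : v = atgt a
    · simp only [hv, and_self, if_true, and_false, if_false]
      revert hax hay hxy
      cases a.1 <;> cases x.1 <;> cases y.1 <;> simp [cycSign]
    · simp [hv]
  simp only [h1, h2, and_false, if_false, sub_self, mul_zero]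
  split_ifs with h3
  · obtain ⟨-, hT, hz, hw⟩ := h3
    by_cases e : z.1 = x.1 ∧ w.1 = y.1
    · exact absurd (hT.unique h hz hw hx hy e.1 e.2) h1
    by_cases e' : z.1 = x'.1 ∧ w.1 = y'.1
    · exact absurd (hT.unique h' hz hw hx' hy' e'.1 e'.2) h2
    rw [htx, hty] at e'
    revert hax hay hxy e e'
    cases a.1 <;> cases x.1 <;> cases y.1 <;> cases z.1 <;> cases w.1 <;> simp [cycSign]
  · rfl

lemma cycDeriv_Wpot_eq_single {l : ℕ} {s : Bool} {a x y : Arr}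
    (ha : ∀ s', HasSign s' a ↔ s' = s) (h : Triangle l a x y)
    (h' : ∀ x' y', Triangle l a x' y' → x'.1 ≠ y.1)
    (hx : HasSign s x) (hy : HasSign s y)
    (hax : a.1 ≠ x.1) (hay : a.1 ≠ y.1) (hxy : x.1 ≠ y.1) :
    cycDeriv (Wpot l) a = cycSign a.1 x.1 y.1 • deltaP (atgt a, [x, y]) := by
  funext ⟨v, L⟩
  by_cases hL : L.length = 2
  swap
  · rw [cycDeriv_Wpot_eq_zero l a hL]
    have h1 : ∀ z w : Arr, ((v, L) : PathD) ≠ (atgt a, [z, w]) := by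
      
      rintro z w h
      apply hL
      rw [Prod.mk.injEq] at h
      simp [h.2]
    simp [deltaP, h1]
  obtain ⟨z, w, rfl⟩ := List.length_eq_two.1 hL
  rw [cycDeriv_Wpot ha]
  simp only [Pi.smul_apply, deltaP, Prod.mk.injEq, List.cons.injEq, and_true, smul_eq_mul]
  by_cases h1 : z = x ∧ w = y
  · obtain ⟨rfl, rfl⟩ := h1
    simp [h, hx, hy]
  simp only [h1, and_false, if_false, mul_zero]
  split_ifs with h3
  · obtain ⟨-, hT, hz, hw⟩ := h3
    by_cases e : z.1 = x.1 ∧ w.1 = y.1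
    · exact absurd (hT.unique h hz hw hx hy e.1 e.2) h1
    have e' := h' z w hT
    revert hax hay hxy e e'
    cases a.1 <;> cases x.1 <;> cases y.1 <;> cases z.1 <;> cases w.1 <;> simp [cycSign]
  · rfl

lemma cycSign_ne_zero {t t' t'' : ArrT} (h : t ≠ t') (h' : t ≠ t'') (h'' : t' ≠ t'') :
    cycSign t t' t'' ≠ 0 := by
  revert h h' h''
  cases t <;> cases t' <;> cases t'' <;> simp [cycSign]

/-! ### Straightening relations

Ordering the arrow types by `A < C < B`, the Jacobian relations allow to exchange adjacent
arrows that are out of order, except at the boundary of the diamond. -/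

/-- The pair `x`, `y` of consecutive arrows can be straightened by a Jacobian relation. -/
def Redex (x y : Arr) : Prop :=
  (x.1 = ArrT.B ∧ y.1 = ArrT.A) ∨ (x.1 = ArrT.C ∧ y.1 = ArrT.A ∧ 1 ≤ x.2.2.1) ∨
    (x.1 = ArrT.B ∧ y.1 = ArrT.C ∧ 1 ≤ x.2.2.2)

/-- Weights of the arrow types realizing the order `A < C < B`. -/
def wt : ArrT → ℕ
  | .A => 0
  | .C => 1
  | .B => 2

lemma coords_of_canon_eq {v w : VT} (h : canon v = canon w) : v.2 = w.2 := by
  have := congrArg Prod.snd h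
  unfold canon at this
  split_ifs at this <;> exact this

lemma sign_of_canon_eq {s s' : Bool} {j k : ℕ} (hj : 1 ≤ j) (hk : 1 ≤ k)
    (h : canon (s, j, k) = canon (s', j, k)) : s = s' := by
  have hj' : j ≠ 0 := by omega
  have hk' : k ≠ 0 := by omega
  simpa [canon, hj', hk'] using h

/-- The arrow of type `A` with given source and sign. -/
def arrA (s : Bool) (j k : ℕ) : Arr := (ArrT.A, if k = 0 then true else s, j, k)

/-- The arrow of type `B` with given source and sign. -/
def arrB (s : Bool) (j k : ℕ) : Arr := (ArrT.B, if j = 0 then true else s, j, k)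

/-- The arrow of type `C` with given source and sign. -/
def arrC (s : Bool) (j k : ℕ) : Arr := (ArrT.C, s, j, k)

lemma asrc_arrA (s : Bool) (j k : ℕ) : asrc (arrA s j k) = canon (s, j, k) := by
  by_cases h : k = 0 <;> simp [arrA, asrc, canon, h]

lemma atgt_arrA (s : Bool) (j k : ℕ) : atgt (arrA s j k) = canon (s, j - 1, k) := by
  by_cases h : k = 0 <;> simp [arrA, atgt, rawTgt, canon, h]

lemma asrc_arrB (s : Bool) (j k : ℕ) : asrc (arrB s j k) = canon (s, j, k) := by
  by_cases h : j = 0 <;> simp [arrB, asrc, canon, h]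

lemma atgt_arrB (s : Bool) (j k : ℕ) : atgt (arrB s j k) = canon (s, j, k + 1) := by
  by_cases h : j = 0 <;> simp [arrB, atgt, rawTgt, canon, h]

lemma asrc_arrC (s : Bool) (j k : ℕ) : asrc (arrC s j k) = canon (s, j, k) := rfl

lemma atgt_arrC (s : Bool) (j k : ℕ) : atgt (arrC s j k) = canon (s, j + 1, k - 1) := rfl

lemma validArr_arrA {l : ℕ} {s : Bool} {j k : ℕ} :
    ValidArr l (arrA s j k) ↔ 1 ≤ j ∧ 2 ≤ j + k ∧ j + k ≤ l := by
  by_cases h : k = 0 <;> simp [arrA, ValidArr, h]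

lemma validArr_arrB {l : ℕ} {s : Bool} {j k : ℕ} :
    ValidArr l (arrB s j k) ↔ 1 ≤ j + k ∧ j + k + 1 ≤ l := by
  by_cases h : j = 0 <;> simp [arrB, ValidArr, h]

lemma validArr_arrC {l : ℕ} {s : Bool} {j k : ℕ} :
    ValidArr l (arrC s j k) ↔ 1 ≤ k ∧ j + k ≤ l := Iff.rfl

lemma hasSign_arrA (s : Bool) (j k : ℕ) : HasSign s (arrA s j k) := by
  by_cases h : k = 0 <;> cases s <;>
    simp [arrA, HasSign, nonnegA, nonposA, bothHoriz, rawTgt, h]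

lemma hasSign_arrB (s : Bool) (j k : ℕ) : HasSign s (arrB s j k) := by
  by_cases h : j = 0 <;> cases s <;>
    simp [arrB, HasSign, nonnegA, nonposA, bothHoriz, rawTgt, h]

lemma hasSign_arrC (s : Bool) (j k : ℕ) : HasSign s (arrC s j k) := by
  cases s <;> simp [arrC, HasSign, nonnegA, nonposA]

lemma hasSign_arrA_iff {s s' : Bool} {j k : ℕ} (hk : 1 ≤ k) (hj : 1 ≤ j) :
    HasSign s' (arrA s j k) ↔ s' = s := by
  have h : k ≠ 0 := by omega
  have h' : j ≠ 0 := by omega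
  cases s <;> cases s' <;> simp [arrA, HasSign, nonnegA, nonposA, bothHoriz, rawTgt, h, h']

lemma hasSign_arrB_iff {s s' : Bool} {j k : ℕ} (hj : 1 ≤ j) :
    HasSign s' (arrB s j k) ↔ s' = s := by
  have h : j ≠ 0 := by omega
  cases s <;> cases s' <;> simp [arrB, HasSign, nonnegA, nonposA, bothHoriz, rawTgt, h]

lemma hasSign_arrC_iff {s s' : Bool} {j k : ℕ} :
    HasSign s' (arrC s j k) ↔ s' = s := by
  cases s <;> cases s' <;> simp [arrC, HasSign, nonnegA, nonposA]

/-- A pair of consecutive arrows forming a redex is one of three standard pairs. -/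
lemma Redex.eq_standard {l : ℕ} {x y : Arr} (hx : ValidArr l x) (hy : ValidArr l y)
    (hxy : asrc y = atgt x) (h : Redex x y) : ∃ s j k,
      (x = arrB s (j + 1) k ∧ y = arrA s (j + 1) (k + 1)) ∨
      (x = arrC s (j + 1) (k + 1) ∧ y = arrA s (j + 2) k) ∨
      (x = arrB s j (k + 1) ∧ y = arrC s j (k + 2)) := by
  obtain ⟨t, s, j, k⟩ := x
  obtain ⟨t', s', j', k'⟩ := y
  have hc := coords_of_canon_eq hxy
  rcases h with ⟨ht, ht'⟩ | ⟨ht, ht', hj⟩ | ⟨ht, ht', hk⟩ <;> simp only at ht ht' <;>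
    subst ht ht' <;>
    simp only [rawTgt, Prod.mk.injEq, ValidArr, asrc, atgt] at hc hx hy hxy <;>
    obtain ⟨rfl, rfl⟩ := hc
  · obtain ⟨j, rfl⟩ := Nat.exists_eq_add_of_le' hy.1
    obtain rfl := sign_of_canon_eq (by omega) (by omega) hxy
    exact ⟨s', j, k, Or.inl ⟨by simp [arrB], by simp [arrA]⟩⟩
  · obtain ⟨j, rfl⟩ := Nat.exists_eq_add_of_le' hj
    obtain ⟨k, rfl⟩ := Nat.exists_eq_add_of_le' hx.1
    refine ⟨s, j, k, Or.inr (Or.inl ⟨rfl, ?_⟩)⟩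
    rcases Nat.eq_zero_or_pos k with rfl | hk
    · simp [arrA, hy.2.2.2 rfl]
    · obtain rfl := sign_of_canon_eq (by omega) (by omega) hxy
      simpa [arrA] using fun h : k = 0 => absurd h (by omega)
  · obtain ⟨k, rfl⟩ := Nat.exists_eq_add_of_le' hk
    refine ⟨s', j', k, Or.inr (Or.inr ⟨?_, rfl⟩)⟩
    rcases Nat.eq_zero_or_pos j' with rfl | hj
    · simp [arrB, hx.2.2 rfl]
    · obtain rfl := sign_of_canon_eq (by omega) (by omega) hxy
      have : j' ≠ 0 := by omega
      simp [arrB, this]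

lemma redex_relation {l : ℕ} {x y : Arr} (hx : ValidArr l x) (hy : ValidArr l y)
    (hxy : asrc y = atgt x) (h : Redex x y) : ∃ (a : Arr) (c : ℂ), c ≠ 0 ∧ Triangle l a x y ∧
      (cycDeriv (Wpot l) a = c • deltaP (atgt a, [x, y]) ∨
        ∃ x' y', Triangle l a x' y' ∧ wt x'.1 = wt y.1 ∧ wt y'.1 = wt x.1 ∧ wt y.1 < wt x.1 ∧
          cycDeriv (Wpot l) a = c • (deltaP (atgt a, [x, y]) - deltaP (atgt a, [x', y']))) := by
  obtain ⟨s, j, k, ⟨rfl, rfl⟩ | ⟨rfl, rfl⟩ | ⟨rfl, rfl⟩⟩ := h.eq_standard hx hy hxy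
  · have hT : Triangle l (arrC s j (k + 1)) (arrB s (j + 1) k) (arrA s (j + 1) (k + 1)) := by
      simp only [validArr_arrA] at hy
      exact ⟨validArr_arrC.2 ⟨by omega, by omega⟩, hx, validArr_arrA.2 hy,
        by rw [asrc_arrB, atgt_arrC]; rfl, hxy, by rw [asrc_arrC, atgt_arrA]; rfl⟩
    refine ⟨arrC s j (k + 1), _, cycSign_ne_zero (t := .C) (t' := .B) (t'' := .A) (by decide)
      (by decide) (by decide), hT, ?_⟩
    by_cases h0 : j = 0 ∧ k = 0
    · left
      obtain ⟨rfl, rfl⟩ := h0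
      refine cycDeriv_Wpot_eq_single (s := s) (fun _ => hasSign_arrC_iff) hT ?_
        (hasSign_arrB _ _ _) (hasSign_arrA _ _ _) (by simp [arrC, arrB]) (by simp [arrC, arrA])
        (by simp [arrA, arrB])
      rintro ⟨t, s', j', k'⟩ y' ⟨-, hv, -, he, -⟩ ht
      obtain rfl : t = ArrT.A := ht
      have hc := coords_of_canon_eq he
      simp only [arrC, rawTgt, Prod.mk.injEq] at hc
      simp only [ValidArr] at hv
      omega
    · right
      refine ⟨arrA s (j + 1) k, arrB s j k, ?_, rfl, rfl, by simp [arrA, arrB, wt],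
        cycDeriv_Wpot_eq_sub (s := s) (fun _ => hasSign_arrC_iff) hT ?_
        (hasSign_arrB _ _ _) (hasSign_arrA _ _ _) (hasSign_arrA _ _ _) (hasSign_arrB _ _ _)
        (by simp [arrC, arrB]) (by simp [arrC, arrA]) (by simp [arrA, arrB]) rfl rfl⟩ <;>
      · simp only [validArr_arrA] at hy
        exact ⟨hT.1, validArr_arrA.2 (by omega), validArr_arrB.2 (by omega),
          by rw [asrc_arrA, atgt_arrC]; rfl, by rw [asrc_arrB, atgt_arrA]; rfl,
          by rw [asrc_arrC, atgt_arrB]⟩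
  · have hT : Triangle l (arrB s (j + 1) k) (arrC s (j + 1) (k + 1)) (arrA s (j + 2) k) := by
      simp only [validArr_arrA] at hy
      exact ⟨validArr_arrB.2 ⟨by omega, by omega⟩, hx, validArr_arrA.2 hy,
        by rw [asrc_arrC, atgt_arrB], hxy, by rw [asrc_arrB, atgt_arrA]; rfl⟩
    refine ⟨arrB s (j + 1) k, _, cycSign_ne_zero (t := .B) (t' := .C) (t'' := .A) (by decide)
      (by decide) (by decide), hT, ?_⟩
    right
    refine ⟨arrA s (j + 1) (k + 1), arrC s j (k + 1), ?_, rfl, rfl, by simp [arrA, arrC, wt],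
      cycDeriv_Wpot_eq_sub (s := s) (fun _ => hasSign_arrB_iff (by omega)) hT ?_
      (hasSign_arrC _ _ _) (hasSign_arrA _ _ _) (hasSign_arrA _ _ _) (hasSign_arrC _ _ _)
      (by simp [arrC, arrB]) (by simp [arrB, arrA]) (by simp [arrA, arrC]) rfl rfl⟩ <;>
    · simp only [validArr_arrA] at hy
      exact ⟨hT.1, validArr_arrA.2 (by omega), validArr_arrC.2 (by omega),
        by rw [asrc_arrA, atgt_arrB], by rw [asrc_arrC, atgt_arrA]; rfl,
        by rw [asrc_arrB, atgt_arrC]; rfl⟩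
  · have hT : Triangle l (arrA s (j + 1) (k + 1)) (arrB s j (k + 1)) (arrC s j (k + 2)) := by
      simp only [validArr_arrC] at hy
      exact ⟨validArr_arrA.2 (by omega), hx, validArr_arrC.2 hy,
        by rw [asrc_arrB, atgt_arrA]; rfl, hxy, by rw [asrc_arrA, atgt_arrC]; rfl⟩
    refine ⟨arrA s (j + 1) (k + 1), _, cycSign_ne_zero (t := .A) (t' := .B) (t'' := .C)
      (by decide) (by decide) (by decide), hT, ?_⟩
    right
    refine ⟨arrC s j (k + 1), arrB s (j + 1) k, ?_, rfl, rfl, by simp [arrB, arrC, wt],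
      cycDeriv_Wpot_eq_sub (s := s) (fun _ => hasSign_arrA_iff (by omega) (by omega)) hT ?_
      (hasSign_arrB _ _ _) (hasSign_arrC _ _ _) (hasSign_arrC _ _ _) (hasSign_arrB _ _ _)
      (by simp [arrA, arrB]) (by simp [arrC, arrA]) (by simp [arrB, arrC]) rfl rfl⟩ <;>
    · simp only [validArr_arrC] at hy
      exact ⟨hT.1, validArr_arrC.2 (by omega), validArr_arrB.2 (by omega),
        by rw [asrc_arrC, atgt_arrA]; rfl, by rw [asrc_arrB, atgt_arrC]; rfl,
        by rw [asrc_arrA, atgt_arrB]⟩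

/-! ### Long paths lie in the Jacobian ideal -/

lemma rmul_deltaP {p q : PathD} (h : endV p.1 p.2 = q.1) :
    rmul (deltaP p) q = deltaP (p.1, p.2 ++ q.2) := by
  funext ⟨v, L⟩
  obtain ⟨w, M⟩ := p
  simp only [rmul, deltaP, Prod.mk.injEq]
  by_cases hL : v = w ∧ L = M ++ q.2
  · obtain ⟨rfl, rfl⟩ := hL
    simp [h]
  · rw [if_neg hL]
    split_ifs with h1 h2
    · obtain ⟨⟨K, rfl⟩, -⟩ := h1
      simp only [List.length_append, Nat.add_sub_cancel, List.take_left] at h2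
      exact absurd ⟨h2.1, by rw [h2.2]⟩ hL
    · rfl
    · rfl

lemma lmul_deltaP {p q : PathD} (h : endV p.1 p.2 = q.1) :
    lmul p (deltaP q) = deltaP (p.1, p.2 ++ q.2) := by
  funext ⟨v, L⟩
  obtain ⟨w, M⟩ := q
  simp only at h
  simp only [lmul, deltaP, Prod.mk.injEq, h, true_and]
  by_cases hL : v = p.1 ∧ L = p.2 ++ M
  · obtain ⟨rfl, rfl⟩ := hL
    simp
  · rw [if_neg hL]
    split_ifs with h1 h2
    · obtain ⟨h1, K, rfl⟩ := h1
      simp only [List.drop_left] at h2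
      exact absurd ⟨h1, by rw [h2]⟩ hL
    · rfl
    · rfl

lemma lmul_smul (p : PathD) (c : ℂ) (f : CPA) : lmul p (c • f) = c • lmul p f := by
  funext q
  simp only [lmul, Pi.smul_apply]
  split_ifs <;> simp

lemma rmul_smul (p : PathD) (c : ℂ) (f : CPA) : rmul (c • f) p = c • rmul f p := by
  funext q
  simp only [rmul, Pi.smul_apply]
  split_ifs <;> simp

lemma lmul_sub (p : PathD) (f g : CPA) : lmul p (f - g) = lmul p f - lmul p g := by
  funext q
  simp only [lmul, Pi.sub_apply]
  split_ifs <;> simp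

lemma rmul_sub (p : PathD) (f g : CPA) : rmul (f - g) p = rmul f p - rmul g p := by
  funext q
  simp only [rmul, Pi.sub_apply]
  split_ifs <;> simp

lemma lmul_rmul_deltaP {v : VT} {a x y : Arr} {U V : List Arr} {l : ℕ} (h : Triangle l a x y)
    (hv : endV v U = atgt a) :
    lmul (v, U) (rmul (deltaP (atgt a, [x, y])) (asrc a, V)) =
      deltaP (v, U ++ [x, y] ++ V) := by
  rw [rmul_deltaP (by exact h.2.2.2.2.2.symm), lmul_deltaP hv, List.append_assoc]

/-- The types of the arrows of a path, read as the digits of a number in base `3`. -/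
def wordValue : List Arr → ℕ
  | [] => 0
  | a :: L => wt a.1 * 3 ^ L.length + wordValue L

lemma wordValue_append (L M : List Arr) :
    wordValue (L ++ M) = wordValue L * 3 ^ M.length + wordValue M := by
  induction L with
  | nil => simp [wordValue]
  | cons a L ih =>
    simp only [List.cons_append, wordValue, ih, List.length_append]
    ring

/-- Two consecutive arrows of the list form a redex. -/
def Reducible (L : List Arr) : Prop := ∃ U x y V, L = U ++ [x, y] ++ V ∧ Redex x y

lemma Reducible.cons {L : List Arr} (h : Reducible L) (a : Arr) : Reducible (a :: L) := by
  obtain ⟨U, x, y, V, rfl, h⟩ := h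
  exact ⟨a :: U, x, y, V, rfl, h⟩

/-- An irreducible path containing an arrow of type `A` starts with such an arrow, possibly
after one arrow of type `C`. -/
lemma exists_eq_cons_of_mem_typeA {l : ℕ} {v : VT} {L : List Arr} (hL : WFfrom l v L)
    (hr : ¬ Reducible L) (hA : ∃ a ∈ L, a.1 = ArrT.A) :
    (∃ a M, L = a :: M ∧ a.1 = ArrT.A) ∨
      ∃ c a M, L = c :: a :: M ∧ c.1 = ArrT.C ∧ c.2.2.1 = 0 ∧ a.1 = ArrT.A := by
  induction L generalizing v with
  | nil => simp at hA
  | cons x L ih =>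
    by_cases hx : x.1 = ArrT.A
    · exact Or.inl ⟨x, L, rfl, hx⟩
    have hA' : ∃ a ∈ L, a.1 = ArrT.A := by
      obtain ⟨a, ha, ht⟩ := hA
      rcases List.mem_cons.1 ha with rfl | ha
      · exact absurd ht hx
      · exact ⟨a, ha, ht⟩
    have hred : ∀ y M, L = y :: M → ¬ Redex x y := fun y M e h =>
      hr ⟨[], x, y, M, by simp [e], h⟩
    rcases ih hL.2.2 (fun h => hr (h.cons x)) hA' with ⟨a, M, rfl, ha⟩ | ⟨c, a, M, rfl, hc, hc0, -⟩
    · have := hred a M rfl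
      cases htx : x.1 with
      | A => exact absurd htx hx
      | B => exact absurd (Or.inl ⟨htx, ha⟩) this
      | C =>
        refine Or.inr ⟨x, a, M, rfl, htx, ?_, ha⟩
        by_contra h0
        exact this (Or.inr (Or.inl ⟨htx, ha, Nat.one_le_iff_ne_zero.2 h0⟩))
    · exfalso
      have hn := hred c _ rfl
      obtain ⟨hvx, -, hvc, hxc, -⟩ := hL
      have hco := coords_of_canon_eq hxc
      obtain ⟨t, s, j, k⟩ := x
      cases t with
      | A => exact hx rfl
      | B =>
        simp only [rawTgt] at hco
        simp only [hco] at hc0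
        subst hc0
        simp only [ValidArr] at hvx
        exact hn (Or.inr (Or.inr ⟨rfl, hc, by simp only; omega⟩))
      | C =>
        simp only [rawTgt] at hco
        simp [hco] at hc0

lemma canon_snd (v : VT) : (canon v).2 = v.2 := by
  unfold canon
  split_ifs <;> rfl

lemma length_le_of_no_typeA {l : ℕ} {v : VT} {L : List Arr} (hL : WFfrom l v L)
    (hA : ∀ a ∈ L, a.1 ≠ ArrT.A) : L.length + 2 * v.2.1 + v.2.2 ≤ 2 * l := by
  induction L generalizing v with
  | nil =>
    have := hL.2.2
    simp only [List.length_nil]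
    omega
  | cons x L ih =>
    obtain ⟨hx, rfl, hL⟩ := hL
    have h1 := ih hL (fun a ha => hA a (List.mem_cons_of_mem _ ha))
    have h2 := hA x List.mem_cons_self
    simp only [asrc, atgt, canon_snd, List.length_cons] at h1 ⊢
    obtain ⟨t, s, j, k⟩ := x
    cases t <;> simp [ValidArr, rawTgt] at hx h1 h2 ⊢ <;> omega

lemma length_le_of_irreducible {l : ℕ} {L : List Arr} {v : VT} (hL : WFfrom l v L)
    (hr : ¬ Reducible L) : L.length ≤ 2 * (v.2.1 + v.2.2) + 2 * l := by
  induction hn : L.length using Nat.strong_induction_on generalizing L v with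
  | _ n ih =>
    subst hn
    by_cases hA : ∃ a ∈ L, a.1 = ArrT.A
    · rcases exists_eq_cons_of_mem_typeA hL hr hA with
        ⟨a, M, rfl, ha⟩ | ⟨c, a, M, rfl, hc, -, ha⟩
      · obtain ⟨hv, rfl, hM⟩ := hL
        have := ih _ (by simp) hM (fun h => hr (h.cons a)) rfl
        obtain ⟨t, s, j, k⟩ := a
        obtain rfl : t = ArrT.A := ha
        simp only [asrc, atgt, canon_snd, List.length_cons, ValidArr, rawTgt] at this hv ⊢
        omega
      · obtain ⟨hv, rfl, hv', he, hM⟩ := hL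
        have := ih _ (by simp) hM (fun h => hr ((h.cons a).cons c)) rfl
        have he := coords_of_canon_eq he
        obtain ⟨t, s, j, k⟩ := a
        obtain rfl : t = ArrT.A := ha
        obtain ⟨t, s', j', k'⟩ := c
        obtain rfl : t = ArrT.C := hc
        simp only [asrc, atgt, canon_snd, List.length_cons, ValidArr, rawTgt,
          Prod.mk.injEq] at this hv hv' he ⊢
        omega
    · push Not at hA
      have := length_le_of_no_typeA hL hA
      omega

lemma deltaP_mem_span {l : ℕ} {v : VT} {L : List Arr} (hL : WFfrom l v L)
    (hlen : 4 * l < L.length) : deltaP (v, L) ∈ Submodule.span ℂ (jacGens l) := by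
  induction hn : wordValue L using Nat.strong_induction_on generalizing L with
  | _ n ih =>
    subst hn
    by_cases hr : Reducible L
    swap
    · have h1 := length_le_of_irreducible hL hr
      have h2 := hL.isVert.2.2
      omega
    obtain ⟨U, x, y, V, rfl, hxy⟩ := hr
    obtain ⟨hUxy, hV⟩ := WFfrom_append.1 hL
    obtain ⟨hU, hx, hUx, hy, hs, -⟩ := WFfrom_append.1 hUxy
    obtain ⟨a, c, hc, hT, h⟩ := redex_relation hx hy hs hxy
    have hend : endV v U = atgt a := hUx.symm.trans hT.2.2.2.1
    rw [endV_append] at hV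
    have hV' : WFfrom l (asrc a) V := by rwa [hT.2.2.2.2.2]
    have hgen : lmul (v, U) (rmul (cycDeriv (Wpot l) a) (asrc a, V)) ∈
        Submodule.span ℂ (jacGens l) :=
      Submodule.subset_span ⟨a, (v, U), (asrc a, V), hT.1, hU, hV', hend, rfl, rfl⟩
    rcases h with h | ⟨x', y', hT', hx', hy', hlt, h⟩
    · rw [h, rmul_smul, lmul_smul, lmul_rmul_deltaP hT hend] at hgen
      exact (Submodule.smul_mem_iff _ hc).1 hgen
    · rw [h, rmul_smul, lmul_smul, rmul_sub, lmul_sub, lmul_rmul_deltaP hT hend,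
        lmul_rmul_deltaP hT' hend, Submodule.smul_mem_iff _ hc] at hgen
      refine (Submodule.sub_mem_iff_left _ (ih _ ?_ ?_ ?_ rfl)).1 hgen
      · simp only [wordValue_append, wordValue, List.length_cons,
          List.length_nil, hx', hy']
        have : wt y.1 * 3 ^ (0 + 1) + (wt x.1 * 3 ^ 0 + 0) <
            wt x.1 * 3 ^ (0 + 1) + (wt y.1 * 3 ^ 0 + 0) := by omega
        gcongr
      · refine WFfrom_append.2 ⟨WFfrom_append.2 ⟨hU, hT'.2.1, ?_, hT'.2.2.1, hT'.2.2.2.2.1,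
          isVert_atgt hT'.2.2.1⟩, ?_⟩
        · rw [hend, hT'.2.2.2.1]
        · rw [endV_append]
          rw [hT'.2.2.2.2.2] at hV'
          exact hV'
      · simpa using hlen

/-! ### Finiteness -/

lemma finite_validArr (l : ℕ) : {a : Arr | ValidArr l a}.Finite := by
  refine Set.Finite.subset (Set.finite_univ.prod (Set.finite_univ.prod
    ((Set.finite_Iic l).prod (Set.finite_Iic l)))) (?_ : _ ⊆
      (Set.univ : Set ArrT) ×ˢ (Set.univ : Set Bool) ×ˢ Set.Iic l ×ˢ Set.Iic l)
  rintro ⟨t, s, j, k⟩ h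
  simp only [Set.mem_prod, Set.mem_univ, Set.mem_Iic, true_and]
  cases t <;> simp only [Set.mem_ofPred_eq, ValidArr] at h <;> omega

lemma finite_isVert (l : ℕ) : {v : VT | IsVert l v}.Finite := by
  refine Set.Finite.subset (Set.finite_univ.prod
    ((Set.finite_Iic l).prod (Set.finite_Iic l))) (?_ : _ ⊆
      (Set.univ : Set Bool) ×ˢ Set.Iic l ×ˢ Set.Iic l)
  rintro ⟨s, j, k⟩ ⟨-, h⟩
  simp only [Set.mem_prod, Set.mem_univ, Set.mem_Iic, true_and] at h ⊢
  omega

lemma finite_WFpath (l n : ℕ) : {p : PathD | WFpath l p ∧ p.2.length ≤ n}.Finite := by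
  have : Finite {a : Arr | ValidArr l a} := finite_validArr l
  refine Set.Finite.subset ((finite_isVert l).prod
    ((List.finite_length_le {a : Arr | ValidArr l a} n).image (List.map Subtype.val))) ?_
  rintro ⟨v, L⟩ ⟨h, hn⟩
  refine ⟨WFfrom.isVert h, L.attach.map fun a => ⟨a.1, WFfrom.validArr h a.2⟩, ?_, ?_⟩
  · change (List.map _ L.attach).length ≤ n
    simpa using hn
  · rw [List.map_map]
    exact List.attach_map_subtype_val L

/-- Coefficient functions supported on long paths lie in the Jacobian ideal. -/
lemma mem_JacIdeal_of_long {l : ℕ} {f : CPA}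
    (hf : ∀ p, f p ≠ 0 → WFpath l p ∧ 4 * l < p.2.length) : f ∈ JacIdeal l := by
  intro n
  refine ⟨∑ p ∈ (finite_WFpath l n).toFinset, f p • deltaP p, ?_, ?_⟩
  · refine Submodule.sum_mem _ fun p _ => ?_
    by_cases h : f p = 0
    · simp [h]
    · exact Submodule.smul_mem _ _ (deltaP_mem_span (hf p h).1 (hf p h).2)
  · intro p hp
    rw [Finset.sum_apply]
    simp only [Pi.smul_apply, deltaP, smul_eq_mul, mul_ite, mul_one, mul_zero,
      Finset.sum_ite_eq, Set.Finite.mem_toFinset, Set.mem_ofPred_eq]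
    split_ifs with h
    · rfl
    · by_contra h0
      exact h ⟨(hf p h0).1, hp⟩

/-- Extension by zero of a function on the set of short paths. -/
def extendShort (l n : ℕ) : ({p : PathD | WFpath l p ∧ p.2.length ≤ n} → ℂ) →ₗ[ℂ] WFsupp l where
  toFun g := ⟨fun p => if h : WFpath l p ∧ p.2.length ≤ n then g ⟨p, h⟩ else 0,
    fun p hp => dif_neg fun h => hp h.1⟩
  map_add' g g' := by
    ext p
    by_cases h : WFpath l p ∧ p.2.length ≤ n <;> simp [h]
  map_smul' c g := by
    ext p
    by_cases h : WFpath l p ∧ p.2.length ≤ n <;> simp [h]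

/-- the Jacobian algebra `J_l = J(Diamond_l, W_l)` is finite-dimensional. -/
theorem statement10 (l : ℕ) (hl : 1 ≤ l) : FiniteDimensional ℂ (Jalg l) := by
  have : Finite {p : PathD | WFpath l p ∧ p.2.length ≤ 4 * l} := finite_WFpath l (4 * l)
  refine Module.Finite.of_surjective
    ((Submodule.mkQ (Submodule.comap (WFsupp l).subtype (JacIdeal l))).comp
      (extendShort l (4 * l))) ?_
  intro z
  obtain ⟨f, rfl⟩ := Submodule.mkQ_surjective _ z
  refine ⟨fun p => f.1 p.1, ?_⟩
  refine (Submodule.Quotient.eq _).2 (mem_JacIdeal_of_long (l := l) fun p hp => ?_)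
  simp only [Submodule.subtype_apply, Submodule.coe_sub, Pi.sub_apply] at hp
  by_cases h : WFpath l p
  · refine ⟨h, ?_⟩
    by_contra hlen
    exact hp (by simp [extendShort, h, not_lt.1 hlen])
  · exact absurd (by simp [extendShort, h, f.2 p h]) hp
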